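/- arXiv:1409.7411 — 3 statements merged into one kernel-verified Lean document; each statement's English description precedes it below -/
import Mathlib

section
/- Let X and R be types and let φ : (X → R) → Set R be a total quantifier (φ p is nonempty for every p). Then the following are equivalent: (i) φ is realistic, i.e. for every context p : X → R with φ p nonempty, φ p meets Set.range p; (ii) φ is attainable, i.e. some total selection function attains φ; (iii) the associated selection function φ̄, defined by φ̄ p = {x | p x ∈ φ p}, is total. -/
/-- For a total quantifier `φ`, the following are equivalent:
(i) `φ` is realistic; (ii) `φ` is attainable; (iii) the associated selection
function `φ̄ p = {x | p x ∈ φ p}` is total. -/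
theorem realistic_iff_attainable_iff_total_selection {X R : Type*}
    (φ : (X → R) → Set R) (htot : ∀ p : X → R, (φ p).Nonempty) :
    List.TFAE
      [ ∀ p : X → R, (φ p).Nonempty → (φ p ∩ Set.range p).Nonempty,
        ∃ ε : (X → R) → Set X,
          (∀ p : X → R, (ε p).Nonempty) ∧ ∀ p : X → R, ∀ x ∈ ε p, p x ∈ φ p,
        ∀ p : X → R, ({x | p x ∈ φ p} : Set X).Nonempty ] := by
  tfae_have 1 → 3 := by
    intro h p
    obtain ⟨_, hr, x, rfl⟩ := h p (htot p)
    exact ⟨x, hr⟩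
  tfae_have 3 → 2 := fun h => ⟨fun p => {x | p x ∈ φ p}, h, fun _ _ hx => hx⟩
  tfae_have 2 → 1 := by
    rintro ⟨ε, hε, hatt⟩ p _
    obtain ⟨x, hx⟩ := hε p
    exact ⟨p x, hatt p x hx, x, rfl⟩
  tfae_finish
end

section
/- Let G be a general n-player game with move types X i, outcome type R, outcome function q : (∀ i, X i) → R, and total selection functions ε i : (X i → R) → Set (X i) (ε i p is nonempty for every p). Define the compiled strategic game G' with the same move types and payoff function q' : (∀ i, X i) → (Fin n → ℝ) given by q' x i = 1 if x i ∈ ε i (U i x) and q' x i = 0 otherwise. Then a strategy profile x is a standard Nash equilibrium of G' (for every i and every x' : X i, q' (Function.update x i x') i ≤ q' x i) if and only if every player receives utility 1, i.e. q' x i = 1 for all i. -/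
open Classical in
/-- In the compiled strategic game `G'` (payoff 1 for a good move
in the unilateral context, 0 otherwise), a profile is a standard Nash
equilibrium iff every player receives utility 1. -/
theorem compiled_nash_iff_all_utility_one {n : ℕ} {X : Fin n → Type*}
    {R : Type*}
    (q : (∀ i, X i) → R)
    (ε : ∀ i, (X i → R) → Set (X i))
    (htot : ∀ i, ∀ p : X i → R, (ε i p).Nonempty)
    (q' : (∀ i, X i) → Fin n → ℝ)
    (hq' : ∀ (x : ∀ i, X i) (i : Fin n),
      q' x i = if x i ∈ ε i (fun x' => q (Function.update x i x')) then 1 else 0)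
    (x : ∀ i, X i) :
    (∀ i, ∀ x' : X i, q' (Function.update x i x') i ≤ q' x i) ↔
    (∀ i, q' x i = 1) := by
  constructor
  · intro h i
    obtain ⟨y, hy⟩ := htot i (fun x' => q (Function.update x i x'))
    have hle := h i y
    have hone : q' (Function.update x i y) i = 1 := by
      simp [hq', Function.update_idem, hy]
    rw [hone, hq'] at hle
    rw [hq']
    split_ifs at hle ⊢ with hx
    · rfl
    · norm_num at hle
  · intro h i x'
    rw [h i, hq']
    split_ifs <;> norm_num
end

section
/- Let G be a general n-player game with move types X i, outcome type R, outcome function q : (∀ i, X i) → R, and total selection functions ε i : (X i → R) → Set (X i). Define the compiled strategic game G' with the same move types and payoff function q' : (∀ i, X i) → (Fin n → ℝ) given by q' x i = 1 if x i ∈ ε i (U i x) and q' x i = 0 otherwise. Then the standard Nash equilibria of G' are exactly the selection equilibria of G: a profile x satisfies (q' (Function.update x i x')) i ≤ (q' x) i for all i and all x' if and only if x i ∈ ε i (U i x) for all i. -/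
open Classical in
/-- The standard Nash equilibria of the compiled game `G'` are
exactly the selection equilibria of the original game `G`. -/
theorem compiled_nash_iff_selection_equilibrium {n : ℕ} {X : Fin n → Type*}
    {R : Type*}
    (q : (∀ i, X i) → R)
    (ε : ∀ i, (X i → R) → Set (X i))
    (htot : ∀ i, ∀ p : X i → R, (ε i p).Nonempty)
    (q' : (∀ i, X i) → Fin n → ℝ)
    (hq' : ∀ (x : ∀ i, X i) (i : Fin n),
      q' x i = if x i ∈ ε i (fun x' => q (Function.update x i x')) then 1 else 0)
    (x : ∀ i, X i) :
    (∀ i, ∀ x' : X i, q' (Function.update x i x') i ≤ q' x i) ↔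
    (∀ i, x i ∈ ε i (fun x' => q (Function.update x i x'))) := by
  constructor
  · intro h i
    by_contra hx
    obtain ⟨y, hy⟩ := htot i (fun x' => q (Function.update x i x'))
    have hle := h i y
    rw [hq', hq', if_neg hx] at hle
    simp only [Function.update_self, Function.update_idem, if_pos hy] at hle
    norm_num at hle
  · intro h i x'
    rw [hq' x i, if_pos (h i), hq']
    split_ifs <;> norm_num
end
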